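/- arXiv:2209.11212 — 4 statements merged into one kernel-verified Lean document; each statement's English description precedes it below -/
import Mathlib

section
/- Let Ω be variational, let Y ∈ ker π be a vertical vector, and let v₁,…,v_m ∈ V span a transverse subspace D of dimension m (so π(D) = W). If for every index j ∈ {1,…,m} and every w ∈ V one has Ω(Y, v₁,…,v_{j−1}, v_{j+1},…, v_m, w) = 0 (i.e. the contraction of ι_Y Ω with every (m−1)-subfamily of the generators vanishes), then ι_Y Ω = 0, i.e. Ω(Y,u₁,…,u_m) = 0 for all u₁,…,u_m ∈ V. -/
theorem aux_span {V : Type*} [AddCommGroup V] [Module ℝ V] {m : ℕ}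
    (β : V [⋀^Fin m]→ₗ[ℝ] ℝ) (v : Fin m → V)
    (h : ∀ (j : Fin m) (w : V), β (Function.update v j w) = 0)
    (d : Fin m → V) (hd : ∀ i, d i ∈ Submodule.span ℝ (Set.range v)) (j : Fin m) (x : V) :
    β (Function.update d j x) = 0 := by
  classical
  have key : ∀ r : Fin m → Fin m, β (fun i => if i = j then x else v (r i)) = 0 := by
    intro r
    by_cases hr : ∃ i i', i ≠ j ∧ i' ≠ j ∧ i ≠ i' ∧ r i = r i'
    · obtain ⟨i, i', hi, hi', hne, heq⟩ := hr
      exact β.map_eq_zero_of_eq _ (by simp [hi, hi', heq]) hne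
    · push Not at hr
      obtain ⟨k, hk⟩ : ∃ k, k ∉ (Finset.univ.erase j).image r := by
        by_contra! hc
        have h1 : (Finset.univ : Finset (Fin m)).card ≤ ((Finset.univ.erase j).image r).card :=
          Finset.card_le_card (fun k _ => hc k)
        have h2 : ((Finset.univ.erase j).image r).card ≤ _ := Finset.card_image_le
        have h3 := Finset.card_erase_lt_of_mem (Finset.mem_univ j)
        omega
      have hk' : ∀ i, i ≠ j → r i ≠ k := by
        intro i hi e
        exact hk (Finset.mem_image.2 ⟨i, by simp [hi], e⟩)
      have hinj : Function.Injective (fun i => if i = j then k else r i) := by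
        intro a b hab
        by_contra hne
        grind
      let σ : Equiv.Perm (Fin m) := Equiv.ofBijective _ (Finite.injective_iff_bijective.1 hinj)
      have e : (fun i => if i = j then x else v (r i)) = (Function.update v k x) ∘ σ := by
        funext i
        by_cases hi : i = j
        · simp [σ, hi]
        · simp [σ, hi, hk' i hi]
      rw [e, β.map_perm, h, smul_zero]
  have hc : ∀ i, ∃ c : Fin m → ℝ, ∑ k, c k • v k = d i := fun i =>
    (Submodule.mem_span_range_iff_exists_fun ℝ).1 (hd i)
  choose c hc using hc
  have e : Function.update d j x = fun i => ∑ k, (if i = j then (if k = j then (1 : ℝ) else 0)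
      else c i k) • (if i = j then x else v k) := by
    funext i
    by_cases hi : i = j
    · subst hi; simp
    · simp [hi, hc]
  rw [e]
  change β.toMultilinearMap _ = 0
  rw [MultilinearMap.map_sum]
  refine Finset.sum_eq_zero fun r _ => ?_
  rw [MultilinearMap.map_smul_univ]
  have := key r
  change β.toMultilinearMap _ = 0 at this
  rw [this, smul_zero]

/-- **Lemma `lem:tech1`.** Let `Ω` be variational (it vanishes whenever
three of its arguments are vertical), let `Y ∈ ker π` be a vertical vector, and let
`v₁,…,v_m` span a transverse subspace of dimension `m`. If for every index `j` and every
`w ∈ V` the contraction of `ι_Y Ω` with the family obtained from `v₁,…,v_m` by replacing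
`v_j` with `w` vanishes (equivalently, `ι_Y Ω` vanishes on every `(m−1)`-subfamily of the
generators together with an arbitrary vector), then `ι_Y Ω = 0`. -/
theorem statement3
    (V W : Type*) [AddCommGroup V] [Module ℝ V] [FiniteDimensional ℝ V]
    [AddCommGroup W] [Module ℝ W] [FiniteDimensional ℝ W]
    (m : ℕ) (hm : 1 ≤ m) (hW : Module.finrank ℝ W = m)
    (π : V →ₗ[ℝ] W) (hπ : Function.Surjective π)
    (Ω : V [⋀^Fin (m + 1)]→ₗ[ℝ] ℝ)
    (hvar : ∀ z : Fin (m + 1) → V, ∀ i j k : Fin (m + 1), i ≠ j → i ≠ k → j ≠ k →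
      z i ∈ LinearMap.ker π → z j ∈ LinearMap.ker π → z k ∈ LinearMap.ker π → Ω z = 0)
    (Y : V) (hY : Y ∈ LinearMap.ker π)
    (v : Fin m → V)
    (htrans : (Submodule.span ℝ (Set.range v)).map π = ⊤)
    (hrank : Module.finrank ℝ (Submodule.span ℝ (Set.range v)) = m)
    (h : ∀ (j : Fin m) (w : V), Ω (Fin.cons Y (Function.update v j w)) = 0) :
    ∀ u : Fin m → V, Ω (Fin.cons Y u) = 0 := by
  classical
  intro u
  have hdec : ∀ i, ∃ d ∈ Submodule.span ℝ (Set.range v), π d = π (u i) := by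
    intro i
    have : π (u i) ∈ (Submodule.span ℝ (Set.range v)).map π := by rw [htrans]; trivial
    exact this
  choose d hd hdu using hdec
  let β : V [⋀^Fin m]→ₗ[ℝ] ℝ := Ω.curryLeft Y
  have hβ : ∀ w, β w = Ω (Fin.cons Y w) := fun w => rfl
  have haux := aux_span β v h d hd
  rw [← hβ]
  have e : u = d + (u - d) := by simp
  rw [e]
  change β.toMultilinearMap _ = 0
  rw [MultilinearMap.map_add_univ]
  refine Finset.sum_eq_zero fun s _ => ?_
  change β _ = 0
  by_cases hs : ∃ i j, i ∉ s ∧ j ∉ s ∧ i ≠ j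
  · obtain ⟨i, j, hi, hj, hij⟩ := hs
    rw [hβ]
    refine hvar _ 0 i.succ j.succ (Fin.succ_ne_zero i).symm (Fin.succ_ne_zero j).symm
      (by simpa using hij) (by simpa using hY) ?_ ?_
    · simp [hi, hdu]
    · simp [hj, hdu]
  · push Not at hs
    obtain ⟨j, hj⟩ : ∃ j : Fin m, ∀ i, i ≠ j → i ∈ s := by
      by_cases hj : ∃ j, j ∉ s
      · obtain ⟨j, hj⟩ := hj
        exact ⟨j, fun i hi => by by_contra hn; exact hi (hs i j hn hj)⟩
      · push Not at hj
        exact ⟨⟨0, hm⟩, fun i _ => hj i⟩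
    have e2 : s.piecewise d (u - d) = Function.update d j (s.piecewise d (u - d) j) := by
      funext i
      by_cases hi : i = j
      · subst hi; simp
      · simp [hi, hj i hi]
    rw [e2]
    exact haux j _
end

section
/- If Ω is variational, every expanded solution decomposes as a solution plus a subspace of the kernel: if D ⊆ V is an expanded solution of Ω, then every vertical vector of D lies in the kernel subspace (D ∩ ker π ⊆ K), and D = H + (D ∩ ker π) where H ⊆ D is a subspace with dim H = m, π(H) = W, and Ω(v₁,…,v_m,w) = 0 for all v₁,…,v_m ∈ H, w ∈ V. -/
/-- **Theorem `theo:ext->kernel`.** If `Ω` is variational, every expanded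
solution decomposes as a solution plus a subspace of the kernel: if `D ⊆ V` is an
expanded solution of `Ω`, then every vertical vector of `D` lies in the kernel subspace
(`D ∩ ker π ⊆ K`), and `D = H + (D ∩ ker π)` where `H ⊆ D` is a subspace with
`dim H = m`, `π(H) = W`, and `Ω(v₁,…,v_m,w) = 0` for all `v₁,…,v_m ∈ H`, `w ∈ V`. -/
theorem statement4
    (V W : Type*) [AddCommGroup V] [Module ℝ V] [FiniteDimensional ℝ V]
    [AddCommGroup W] [Module ℝ W] [FiniteDimensional ℝ W]
    (m : ℕ) (hm : 1 ≤ m) (hW : Module.finrank ℝ W = m)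
    (π : V →ₗ[ℝ] W) (hπ : Function.Surjective π)
    (Ω : V [⋀^Fin (m + 1)]→ₗ[ℝ] ℝ)
    (hvar : ∀ z : Fin (m + 1) → V, ∀ i j k : Fin (m + 1), i ≠ j → i ≠ k → j ≠ k →
      z i ∈ LinearMap.ker π → z j ∈ LinearMap.ker π → z k ∈ LinearMap.ker π → Ω z = 0)
    (D : Submodule ℝ V) (hDt : D.map π = ⊤)
    (hDs : ∀ v : Fin m → V, (∀ i, v i ∈ D) → ∀ w : V, Ω (Fin.snoc v w) = 0) :
    (∀ y ∈ D ⊓ LinearMap.ker π, ∀ u : Fin m → V, Ω (Fin.cons y u) = 0) ∧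
      ∃ H : Submodule ℝ V, H ≤ D ∧ Module.finrank ℝ H = m ∧ H.map π = ⊤ ∧
        (∀ v : Fin m → V, (∀ i, v i ∈ H) → ∀ w : V, Ω (Fin.snoc v w) = 0) ∧
        D = H ⊔ (D ⊓ LinearMap.ker π) := by
  have key : ∀ (z : Fin (m + 1) → V) (j : Fin (m + 1)), (∀ i, i ≠ j → z i ∈ D) → Ω z = 0 := by
    intro z j hz
    have h0 : Ω (z ∘ Equiv.swap j (Fin.last m)) = 0 := by
      rw [← Fin.snoc_init_self (z ∘ Equiv.swap j (Fin.last m))]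
      apply hDs
      intro i
      apply hz
      intro h
      have h2 := congrArg (Equiv.swap j (Fin.last m)) h
      simp only [Equiv.swap_apply_self, Equiv.swap_apply_left] at h2
      exact (Fin.castSucc_lt_last i).ne h2
    rw [Ω.map_perm] at h0
    rcases Int.units_eq_one_or (Equiv.Perm.sign (Equiv.swap j (Fin.last m))) with h | h
    · simpa [h] using h0
    · simpa [h] using h0
  have hlift : ∀ w : W, ∃ d ∈ D, π d = w := by
    intro w
    have : w ∈ D.map π := by rw [hDt]; trivial
    simpa using this
  refine ⟨?_, ?_⟩
  · rintro y ⟨hyD, hyk⟩ u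
    choose d hd hdπ using fun i => hlift (π (u i))
    have hsum : (Fin.cons y u : Fin (m + 1) → V)
        = (Fin.cons y d : Fin (m + 1) → V) + (Fin.cons 0 (fun i => u i - d i)) := by
      funext i
      refine Fin.cases ?_ (fun i => ?_) i <;> simp
    have hmain : Ω.toMultilinearMap (Fin.cons y u : Fin (m + 1) → V) = 0 := by
      rw [hsum, MultilinearMap.map_add_univ]
      apply Finset.sum_eq_zero
      intro s _
      change Ω _ = 0
      by_cases h0 : (0 : Fin (m + 1)) ∈ s
      · have hker : ∀ i, i ∉ s → s.piecewise (Fin.cons y d : Fin (m + 1) → V)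
            (Fin.cons 0 (fun i => u i - d i)) i ∈ LinearMap.ker π := by
          intro i hi
          rw [Finset.piecewise_eq_of_notMem _ _ _ hi]
          refine Fin.cases ?_ (fun i => ?_) i <;> simp [hdπ]
        have hDmem : ∀ i, i ∈ s → s.piecewise (Fin.cons y d : Fin (m + 1) → V)
            (Fin.cons 0 (fun i => u i - d i)) i ∈ D := by
          intro i hi
          rw [Finset.piecewise_eq_of_mem _ _ _ hi]
          refine Fin.cases ?_ (fun i => ?_) i
          · simpa using hyD
          · simpa using hd i
        by_cases hex : ∃ i j, i ∉ s ∧ j ∉ s ∧ i ≠ j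
        · obtain ⟨i, j, hi, hj, hij⟩ := hex
          refine hvar _ 0 i j ?_ ?_ hij ?_ (hker i hi) (hker j hj)
          · rintro rfl; exact hi h0
          · rintro rfl; exact hj h0
          · rw [Finset.piecewise_eq_of_mem _ _ _ h0]
            simpa using hyk
        · push Not at hex
          by_cases hn : ∃ j, j ∉ s
          · obtain ⟨j, hj⟩ := hn
            refine key _ j fun i hij => hDmem i ?_
            by_contra hi
            exact hij (hex i j hi hj)
          · push Not at hn
            exact key _ 0 fun i _ => hDmem i (hn i)
      · apply Ω.map_coord_zero 0
        rw [Finset.piecewise_eq_of_notMem _ _ _ h0]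
        simp
    exact hmain
  · have hsurj : LinearMap.range (π.comp D.subtype) = ⊤ := by
      rw [LinearMap.range_comp, Submodule.range_subtype, hDt]
    obtain ⟨g, hg⟩ := LinearMap.exists_rightInverse_of_surjective _ hsurj
    have hg' : ∀ w, π (g w : V) = w := fun w => by
      simpa using LinearMap.congr_fun hg w
    have hle : LinearMap.range (D.subtype.comp g) ≤ D := by
      rintro _ ⟨w, rfl⟩
      exact (g w).2
    refine ⟨LinearMap.range (D.subtype.comp g), hle, ?_, ?_, ?_, ?_⟩
    · rw [LinearMap.finrank_range_of_inj, hW]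
      intro a b hab
      have := congrArg π hab
      simpa [hg'] using this
    · rw [eq_top_iff]
      intro w _
      exact ⟨g w, ⟨w, rfl⟩, hg' w⟩
    · exact fun v hv w => hDs v (fun i => hle (hv i)) w
    · apply le_antisymm
      · intro x hx
        rw [Submodule.mem_sup]
        refine ⟨g (π x), ⟨π x, rfl⟩, x - g (π x), ⟨D.sub_mem hx (g (π x)).2, ?_⟩, by simp⟩
        simp [hg']
      · exact sup_le hle inf_le_left
end

section
/- Let Ω be variational and assume there exists at least one solution (a transverse subspace D₀ with dim D₀ = m and Ω(v₁,…,v_m,w) = 0 for all v_i ∈ D₀, w ∈ V). Then Ω admits a non-trivial expanded solution (an expanded solution D with dim D > m) if and only if the kernel subspace K = {v ∈ ker π : ι_v Ω = 0} is nonzero. -/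
theorem aux_snoc {V : Type*} [AddCommGroup V] [Module ℝ V] {m : ℕ}
    (Ω : V [⋀^Fin (m + 1)]→ₗ[ℝ] ℝ) (D : Submodule ℝ V)
    (h : ∀ v : Fin m → V, (∀ i, v i ∈ D) → ∀ w : V, Ω (Fin.snoc v w) = 0)
    (z : Fin (m + 1) → V) (j : Fin (m + 1)) (hz : ∀ i, i ≠ j → z i ∈ D) : Ω z = 0 := by
  have h1 := Ω.map_perm z (Equiv.swap j (Fin.last m))
  have h2 : Ω (z ∘ Equiv.swap j (Fin.last m)) = 0 := by
    rw [← Fin.snoc_init_self (z ∘ Equiv.swap j (Fin.last m))]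
    apply h
    intro i
    simp only [Fin.init, Function.comp]
    apply hz
    intro hi
    have h3 : i.castSucc = Fin.last m := by
      rw [Equiv.swap_apply_eq_iff] at hi
      simpa using hi
    exact (Fin.castSucc_lt_last i).ne h3
  rw [h2] at h1
  rcases Int.units_eq_one_or (Equiv.Perm.sign (Equiv.swap j (Fin.last m))) with h4 | h4 <;>
    rw [h4] at h1 <;> simpa using h1.symm

theorem aux_cons {V : Type*} [AddCommGroup V] [Module ℝ V] {m : ℕ}
    (Ω : V [⋀^Fin (m + 1)]→ₗ[ℝ] ℝ) (g : V)
    (h : ∀ u : Fin m → V, Ω (Fin.cons g u) = 0)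
    (z : Fin (m + 1) → V) (j : Fin (m + 1)) (hz : z j ∈ Submodule.span ℝ {g}) : Ω z = 0 := by
  obtain ⟨c, hc⟩ := Submodule.mem_span_singleton.1 hz
  rw [← Function.update_eq_self j z, ← hc, Ω.map_update_smul]
  set y := Function.update z j g with hy
  have h1 := Ω.map_perm y (Equiv.swap j 0)
  have h2 : Ω (y ∘ Equiv.swap j 0) = 0 := by
    rw [← Fin.cons_self_tail (y ∘ Equiv.swap j 0)]
    have : (y ∘ Equiv.swap j 0) 0 = g := by simp [hy]
    rw [this]
    apply h
  rw [h2] at h1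
  have h5 : Ω y = 0 := by
    rcases Int.units_eq_one_or (Equiv.Perm.sign (Equiv.swap j (0 : Fin (m + 1)))) with h4 | h4 <;>
      rw [h4] at h1 <;> simpa using h1.symm
  rw [h5, smul_zero]

/-- **Corollary.** Let `Ω` be variational and assume there exists at least
one solution (a transverse subspace `D₀` with `dim D₀ = m` on which `Ω` vanishes against
arbitrary vectors). Then `Ω` admits a non-trivial expanded solution (an expanded solution
`D` with `dim D > m`) if and only if the kernel subspace
`K = {v ∈ ker π : ι_v Ω = 0}` is nonzero. -/
theorem statement5
    (V W : Type*) [AddCommGroup V] [Module ℝ V] [FiniteDimensional ℝ V]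
    [AddCommGroup W] [Module ℝ W] [FiniteDimensional ℝ W]
    (m : ℕ) (hm : 1 ≤ m) (hW : Module.finrank ℝ W = m)
    (π : V →ₗ[ℝ] W) (hπ : Function.Surjective π)
    (Ω : V [⋀^Fin (m + 1)]→ₗ[ℝ] ℝ)
    (hvar : ∀ z : Fin (m + 1) → V, ∀ i j k : Fin (m + 1), i ≠ j → i ≠ k → j ≠ k →
      z i ∈ LinearMap.ker π → z j ∈ LinearMap.ker π → z k ∈ LinearMap.ker π → Ω z = 0)
    (hexist : ∃ D₀ : Submodule ℝ V, D₀.map π = ⊤ ∧ Module.finrank ℝ D₀ = m ∧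
      ∀ v : Fin m → V, (∀ i, v i ∈ D₀) → ∀ w : V, Ω (Fin.snoc v w) = 0) :
    (∃ D : Submodule ℝ V, D.map π = ⊤ ∧
        (∀ v : Fin m → V, (∀ i, v i ∈ D) → ∀ w : V, Ω (Fin.snoc v w) = 0) ∧
        m < Module.finrank ℝ D) ↔
      ∃ g : V, g ≠ 0 ∧ g ∈ LinearMap.ker π ∧ ∀ u : Fin m → V, Ω (Fin.cons g u) = 0 := by
  classical
  constructor
  · rintro ⟨D, hD, hΩ, hdim⟩
    have hA := aux_snoc Ω D hΩ
    obtain ⟨g, hg, hg0⟩ : ∃ g ∈ LinearMap.ker (π.domRestrict D), g ≠ 0 := by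
      apply Submodule.exists_mem_ne_zero_of_ne_bot
      apply LinearMap.ker_ne_bot_of_finrank_lt
      omega
    have hgk : π g = 0 := by simpa using hg
    refine ⟨g, by simpa using hg0, hgk, fun u => ?_⟩
    have hdec : ∀ x : V, ∃ d ∈ D, π (x - d) = 0 := by
      intro x
      have : π x ∈ D.map π := by rw [hD]; trivial
      obtain ⟨d, hd, hdx⟩ := this
      exact ⟨d, hd, by simp [hdx]⟩
    choose d hd hdk using hdec
    have hz : (Fin.cons g u : Fin (m + 1) → V) =
        (Fin.cons g (fun i => d (u i)) : Fin (m + 1) → V) +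
          (Fin.cons 0 (fun i => u i - d (u i)) : Fin (m + 1) → V) := by
      funext i
      refine Fin.cases ?_ (fun i => ?_) i <;> simp
    have haD : ∀ i, (Fin.cons (g : V) (fun i => d (u i)) : Fin (m + 1) → V) i ∈ D := by
      intro i
      refine Fin.cases ?_ (fun i => ?_) i <;> simp [hd]
    have hbk : ∀ i, (Fin.cons 0 (fun i => u i - d (u i)) : Fin (m + 1) → V) i
        ∈ LinearMap.ker π := by
      intro i
      refine Fin.cases ?_ (fun i => ?_) i
      · simp
      · simpa using hdk (u i)
    have ha0 : (Fin.cons (g : V) (fun i => d (u i)) : Fin (m + 1) → V) 0 = g := rfl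
    have hb0 : (Fin.cons 0 (fun i => u i - d (u i)) : Fin (m + 1) → V) 0 = 0 := rfl
    rw [hz]
    generalize (Fin.cons (g : V) (fun i => d (u i)) : Fin (m + 1) → V) = a at *
    generalize (Fin.cons 0 (fun i => u i - d (u i)) : Fin (m + 1) → V) = b at *
    have hexp := Ω.toMultilinearMap.map_add_univ a b
    simp only [AlternatingMap.coe_multilinearMap] at hexp
    rw [hexp]
    apply Finset.sum_eq_zero
    intro s _
    by_cases h0 : (0 : Fin (m + 1)) ∈ s
    · by_cases h2 : ∃ j k, j ∉ s ∧ k ∉ s ∧ j ≠ k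
      · obtain ⟨j, k, hj, hk, hjk⟩ := h2
        refine hvar _ 0 j k ?_ ?_ hjk ?_ ?_ ?_
        · rintro rfl; exact hj h0
        · rintro rfl; exact hk h0
        · simp [h0, ha0, hgk]
        · rw [Finset.piecewise_eq_of_notMem _ _ _ hj]; exact hbk j
        · rw [Finset.piecewise_eq_of_notMem _ _ _ hk]; exact hbk k
      · push Not at h2
        by_cases h1 : ∃ j, j ∉ s
        · obtain ⟨j, hj⟩ := h1
          refine hA _ j fun i hi => ?_
          have his : i ∈ s := by
            by_contra his
            exact hi (h2 i j his hj)
          rw [Finset.piecewise_eq_of_mem _ _ _ his]; exact haD i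
        · push Not at h1
          refine hA _ 0 fun i hi => ?_
          rw [Finset.piecewise_eq_of_mem _ _ _ (h1 i)]; exact haD i
    · apply Ω.map_coord_zero 0
      rw [Finset.piecewise_eq_of_notMem _ _ _ h0, hb0]
  · rintro ⟨g, hg0, hgk, hg⟩
    obtain ⟨D₀, hD, hdim, hΩ⟩ := hexist
    have hA := aux_snoc Ω D₀ hΩ
    have hB := aux_cons Ω g hg
    refine ⟨D₀ ⊔ Submodule.span ℝ {g}, ?_, ?_, ?_⟩
    · rw [eq_top_iff, ← hD]
      exact Submodule.map_mono le_sup_left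
    · intro v hv w
      have hdec : ∀ i, ∃ x ∈ D₀, ∃ y ∈ Submodule.span ℝ {g}, x + y = v i :=
        fun i => Submodule.mem_sup.1 (hv i)
      choose x hx y hy hxy using hdec
      have hz : (Fin.snoc v w : Fin (m + 1) → V) =
          (Fin.snoc x w : Fin (m + 1) → V) + (Fin.snoc y 0 : Fin (m + 1) → V) := by
        funext i
        refine Fin.lastCases ?_ (fun i => ?_) i <;> simp [hxy]
      have hexp := Ω.toMultilinearMap.map_add_univ
        (Fin.snoc x w : Fin (m + 1) → V) (Fin.snoc y 0 : Fin (m + 1) → V)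
      simp only [AlternatingMap.coe_multilinearMap] at hexp
      rw [hz, hexp]
      apply Finset.sum_eq_zero
      intro s _
      by_cases h1 : ∃ j, j ∉ s
      · obtain ⟨j, hj⟩ := h1
        apply hB _ j
        rw [Finset.piecewise_eq_of_notMem _ _ _ hj]
        refine Fin.lastCases ?_ (fun i => ?_) j
        · simp
        · simpa using hy i
      · push Not at h1
        refine hA _ (Fin.last m) fun i hi => ?_
        rw [Finset.piecewise_eq_of_mem _ _ _ (h1 i)]
        revert hi
        refine Fin.lastCases ?_ (fun i => ?_) i
        · simp
        · intro _; simpa using hx i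
    · rw [← hdim]
      apply Submodule.finrank_lt_finrank_of_lt
      rw [left_lt_sup, Submodule.span_singleton_le_iff_mem]
      intro hgD
      have hsurj : Function.Surjective (π.domRestrict D₀) := by
        intro y
        have : y ∈ D₀.map π := by rw [hD]; trivial
        obtain ⟨d, hd, hdx⟩ := this
        exact ⟨⟨d, hd⟩, hdx⟩
      have hinj : Function.Injective (π.domRestrict D₀) :=
        (LinearMap.injective_iff_surjective_of_finrank_eq_finrank (hdim.trans hW.symm)).2 hsurj
      have : (⟨g, hgD⟩ : D₀) = 0 := hinj (by simpa using hgk)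
      exact hg0 (congrArg Subtype.val this)
end

section
/- If Ω is variational, the kernel relation on expanded solutions is an equivalence relation. Precisely, declare D₁ ∼ D₂ for expanded solutions D₁, D₂ iff D₁ + D₂ is an expanded solution; then ∼ is reflexive, symmetric, and transitive on the set of expanded solutions. In particular, if D₁, D₂, D₃ are expanded solutions such that D₁ + D₂ and D₂ + D₃ are expanded solutions, then D₁ + D₃ is an expanded solution. -/
/-- A subspace `D ⊆ V` is an expanded solution of the alternating `(m+1)`-form `Ω`
if it is transverse (`π(D) = W`) and `Ω(v₁,…,v_m,w) = 0` for all `v₁,…,v_m ∈ D` and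
all `w ∈ V`. -/
def IsExpandedSolution {V W : Type*} [AddCommGroup V] [Module ℝ V]
    [AddCommGroup W] [Module ℝ W] {m : ℕ}
    (π : V →ₗ[ℝ] W) (Ω : V [⋀^Fin (m + 1)]→ₗ[ℝ] ℝ) (D : Submodule ℝ V) : Prop :=
  D.map π = ⊤ ∧ ∀ v : Fin m → V, (∀ i, v i ∈ D) → ∀ w : V, Ω (Fin.snoc v w) = 0

/-- Changing arguments one at a time. -/
theorem omega_congr {V : Type*} [AddCommGroup V] [Module ℝ V] {n : ℕ}
    (Ω : V [⋀^Fin n]→ₗ[ℝ] ℝ) (u u' : Fin n → V)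
    (h : ∀ w : Fin n → V, (∀ l, u' l = u l → w l = u l) →
      ∀ k, u' k ≠ u k → w k = u' k - u k → Ω w = 0) : Ω u' = Ω u := by
  classical
  have key : ∀ s : Finset (Fin n), Ω (s.piecewise u' u) = Ω u := by
    intro s
    induction s using Finset.induction_on with
    | empty => simp
    | insert a s ha ih =>
      rw [← ih, Finset.piecewise_insert]
      by_cases hk : u' a = u a
      · congr 1
        funext l
        by_cases hl : l = a
        · subst hl; simp [ha, hk]
        · simp [Function.update_of_ne hl]
      · have h0 := h (Function.update (s.piecewise u' u) a (u' a - u a)) (by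
          intro l hl
          have hla : l ≠ a := by rintro rfl; exact hk hl
          rw [Function.update_of_ne hla]
          by_cases hs : l ∈ s <;> simp [hs, hl]) a hk (by simp)
        rw [Ω.map_update_sub] at h0
        have h1 : Function.update (s.piecewise u' u) a (u a) = s.piecewise u' u := by
          conv_rhs => rw [← Function.update_eq_self a (s.piecewise u' u)]
          simp [ha]
        rw [h1] at h0
        linarith
  simpa using key Finset.univ

/-- The free slot of an expanded solution can be anywhere. -/
theorem sol_any {V W : Type*} [AddCommGroup V] [Module ℝ V]
    [AddCommGroup W] [Module ℝ W] {m : ℕ}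
    {π : V →ₗ[ℝ] W} {Ω : V [⋀^Fin (m + 1)]→ₗ[ℝ] ℝ} {D : Submodule ℝ V}
    (hD : IsExpandedSolution π Ω D) (u : Fin (m + 1) → V) (j : Fin (m + 1))
    (hu : ∀ l, l ≠ j → u l ∈ D) : Ω u = 0 := by
  classical
  have h1 : Ω (u ∘ Equiv.swap j (Fin.last m)) = 0 := by
    rw [← Fin.snoc_init_self (u ∘ Equiv.swap j (Fin.last m))]
    apply hD.2
    intro i
    apply hu
    intro h
    have h2 : Equiv.swap j (Fin.last m) i.castSucc = Equiv.swap j (Fin.last m) (Fin.last m) := by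
      rw [Equiv.swap_apply_right]; exact h
    have h3 := (Equiv.swap j (Fin.last m)).injective h2
    exact (Fin.castSucc_lt_last i).ne h3
  rw [Ω.map_perm] at h1
  rcases Int.units_eq_one_or (Equiv.Perm.sign (Equiv.swap j (Fin.last m))) with h | h <;>
    simpa [h] using h1

/-- Vertical vectors of an expanded solution annihilate a variational form. -/
theorem vert_rad {V W : Type*} [AddCommGroup V] [Module ℝ V]
    [AddCommGroup W] [Module ℝ W] {m : ℕ}
    {π : V →ₗ[ℝ] W} {Ω : V [⋀^Fin (m + 1)]→ₗ[ℝ] ℝ}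
    (hvar : ∀ z : Fin (m + 1) → V, ∀ i j k : Fin (m + 1), i ≠ j → i ≠ k → j ≠ k →
      z i ∈ LinearMap.ker π → z j ∈ LinearMap.ker π → z k ∈ LinearMap.ker π → Ω z = 0)
    {D : Submodule ℝ V} (hD : IsExpandedSolution π Ω D) {x : V} (hx : x ∈ D)
    (hxk : π x = 0) (u : Fin (m + 1) → V) (i : Fin (m + 1)) (hi : u i = x) : Ω u = 0 := by
  classical
  have lift : ∀ y : V, ∃ d ∈ D, π d = π y := by
    intro y
    have : π y ∈ D.map π := by rw [hD.1]; trivial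
    simpa using this
  choose g hgD hg using lift
  have step1 : ∀ u : Fin (m + 1) → V, u i = x → ∀ j, j ≠ i → π (u j) = 0 → Ω u = 0 := by
    intro u hi j hji hj
    rw [← omega_congr Ω u (fun l => if l = i ∨ l = j then u l else g (u l))]
    · apply sol_any hD _ j
      intro l hl
      by_cases hli : l = i
      · subst hli; simpa [hi] using hx
      · simpa [hl, hli] using hgD _
    · intro w hw k hk hwk
      have hki : ¬ (k = i ∨ k = j) := fun h => hk (by simp [h])
      simp only [hki, if_false] at hwk
      rw [not_or] at hki
      apply hvar w i j k (Ne.symm hji) (Ne.symm hki.1) (Ne.symm hki.2)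
      · rw [hw i (by simp), hi]; exact hxk
      · rw [hw j (by simp)]; exact hj
      · rw [hwk]; simp [hg]
  rw [← omega_congr Ω u (fun l => if l = i then u l else g (u l))]
  · apply sol_any hD _ i
    intro l hl
    simpa [hl] using hgD _
  · intro w hw k hk hwk
    have hki : ¬ (k = i) := fun h => hk (by simp [h])
    simp only [hki, if_false] at hwk
    apply step1 w (by rw [hw i (by simp), hi]) k hki
    rw [hwk]; simp [hg]


/-- **Proposition `prop:equivrel`.** If `Ω` is variational, the kernel
relation on expanded solutions (declaring `D₁ ∼ D₂` iff `D₁ + D₂` is an expanded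
solution) is reflexive, symmetric, and transitive.  In particular, if `D₁, D₂, D₃` are
expanded solutions such that `D₁ + D₂` and `D₂ + D₃` are expanded solutions, then
`D₁ + D₃` is an expanded solution. -/
theorem statement6
    (V W : Type*) [AddCommGroup V] [Module ℝ V] [FiniteDimensional ℝ V]
    [AddCommGroup W] [Module ℝ W] [FiniteDimensional ℝ W]
    (m : ℕ) (hm : 1 ≤ m) (hW : Module.finrank ℝ W = m)
    (π : V →ₗ[ℝ] W) (hπ : Function.Surjective π)
    (Ω : V [⋀^Fin (m + 1)]→ₗ[ℝ] ℝ)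
    (hvar : ∀ z : Fin (m + 1) → V, ∀ i j k : Fin (m + 1), i ≠ j → i ≠ k → j ≠ k →
      z i ∈ LinearMap.ker π → z j ∈ LinearMap.ker π → z k ∈ LinearMap.ker π → Ω z = 0) :
    (∀ D : Submodule ℝ V, IsExpandedSolution π Ω D → IsExpandedSolution π Ω (D ⊔ D)) ∧
    (∀ D₁ D₂ : Submodule ℝ V, IsExpandedSolution π Ω D₁ → IsExpandedSolution π Ω D₂ →
      IsExpandedSolution π Ω (D₁ ⊔ D₂) → IsExpandedSolution π Ω (D₂ ⊔ D₁)) ∧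
    (∀ D₁ D₂ D₃ : Submodule ℝ V, IsExpandedSolution π Ω D₁ → IsExpandedSolution π Ω D₂ →
      IsExpandedSolution π Ω D₃ → IsExpandedSolution π Ω (D₁ ⊔ D₂) →
      IsExpandedSolution π Ω (D₂ ⊔ D₃) → IsExpandedSolution π Ω (D₁ ⊔ D₃)) := by
  refine ⟨fun D h => by simpa using h, fun D₁ D₂ _ _ h => by rwa [sup_comm], ?_⟩
  intro D₁ D₂ D₃ h1 h2 h3 h12 h23
  have lift : ∀ D : Submodule ℝ V, IsExpandedSolution π Ω D → ∀ y : V, ∃ d ∈ D, π d = π y := by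
    intro D hD y
    have : π y ∈ D.map π := by rw [hD.1]; trivial
    simpa using this
  have rad : ∀ x ∈ D₁ ⊔ D₃, π x = 0 → ∀ (u : Fin (m + 1) → V) (i : Fin (m + 1)),
      u i = x → Ω u = 0 := by
    intro x hx hx0 u i hi
    obtain ⟨a, ha, c, hc, rfl⟩ := Submodule.mem_sup.1 hx
    obtain ⟨b, hb, hba⟩ := lift D₂ h2 a
    have e : u = Function.update u i ((a - b) + (b + c)) := by
      have e1 : (a - b) + (b + c) = u i := by rw [hi]; abel
      rw [e1, Function.update_eq_self]
    rw [e, Ω.map_update_add]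
    rw [vert_rad hvar h12 (x := a - b) (Submodule.sub_mem _ (Submodule.mem_sup_left ha)
      (Submodule.mem_sup_right hb)) (by simp [hba]) _ i (by simp)]
    rw [vert_rad hvar h23 (x := b + c) (Submodule.add_mem _ (Submodule.mem_sup_left hb)
      (Submodule.mem_sup_right hc)) (by rw [map_add, hba, ← map_add, hx0]) _ i (by simp)]
    simp
  refine ⟨by rw [Submodule.map_sup, h1.1]; simp, ?_⟩
  intro v hv w
  choose g hgD hg using lift D₁ h1
  rw [← omega_congr Ω (Fin.snoc v w : Fin (m + 1) → V)
    (Fin.snoc (fun l => g (v l)) w : Fin (m + 1) → V)]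
  · exact h1.2 _ (fun i => hgD _) w
  · intro y hy k hk hyk
    induction k using Fin.lastCases with
    | last => simp at hk
    | cast k =>
      simp only [Fin.snoc_castSucc] at hyk
      exact rad _ (Submodule.sub_mem _ (Submodule.mem_sup_left (hgD _)) (hv k))
        (by simp [hg]) y _ hyk
end
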